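/- arXiv:2208.01465 — 2 statements merged into one kernel-verified Lean document; each statement's English description precedes it below -/
import Mathlib

section
/- Let G be the symmetric integer matrix [[0,1,1,1],[1,-2,0,2],[1,0,-2,3],[1,2,3,-2]] (the Gram matrix of the lattice L_15). Then the cokernel Z^4/(G·Z^4) of the linear map Z^4 → Z^4 given by G is isomorphic as an abelian group to Z/31Z. Moreover the rational vector α = (13/31, 5/31, 12/31, 14/31) satisfies G·α ∈ Z^4 and αᵀGα − 44/31 ∈ 2Z. -/
open Matrix

/-- The homomorphism `ℤ⁴ → ℤ/31` whose kernel is the image of the Gram matrix of `L₁₅`. -/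
def discriminantHom : (Fin 4 → ℤ) →+ ZMod 31 where
  toFun x := ((13 * x 0 + 5 * x 1 + 12 * x 2 + 14 * x 3 : ℤ) : ZMod 31)
  map_zero' := by simp
  map_add' x y := by
    simp only [Pi.add_apply]
    push_cast
    ring

theorem discriminantHom_apply (x : Fin 4 → ℤ) :
    discriminantHom x = ((13 * x 0 + 5 * x 1 + 12 * x 2 + 14 * x 3 : ℤ) : ZMod 31) := rfl

theorem discriminantHom_surjective : Function.Surjective discriminantHom := by
  intro z
  obtain ⟨n, rfl⟩ := ZMod.intCast_surjective z
  refine ⟨![12 * n, 0, 0, 0], ?_⟩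
  rw [discriminantHom_apply, ← sub_eq_zero, ← Int.cast_sub]
  refine (ZMod.intCast_zmod_eq_zero_iff_dvd _ 31).2 ⟨5 * n, ?_⟩
  simp
  ring

theorem range_mulVecLin_eq_ker_discriminantHom :
    (LinearMap.range (Matrix.mulVecLin
      (!![0, 1, 1, 1; 1, -2, 0, 2; 1, 0, -2, 3; 1, 2, 3, -2] : Matrix (Fin 4) (Fin 4) ℤ))
      ).toAddSubgroup = discriminantHom.ker := by
  ext x
  rw [Submodule.mem_toAddSubgroup, LinearMap.mem_range, AddMonoidHom.mem_ker,
    discriminantHom_apply]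
  refine Iff.trans ?_ (ZMod.intCast_zmod_eq_zero_iff_dvd _ 31).symm
  constructor
  · rintro ⟨y, rfl⟩
    refine ⟨y 0 + y 1 + y 2 + y 3, ?_⟩
    simp [Matrix.mulVec, dotProduct, Fin.sum_univ_four]
    ring
  · rintro ⟨k, hk⟩
    refine ⟨![156 * k - 66 * x 0 - 25 * x 1 - 60 * x 2 - 70 * x 3,
      60 * k - 25 * x 0 - 10 * x 1 - 23 * x 2 - 27 * x 3,
      144 * k - 60 * x 0 - 23 * x 1 - 56 * x 2 - 65 * x 3,
      168 * k - 70 * x 0 - 27 * x 1 - 65 * x 2 - 76 * x 3], ?_⟩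
    push_cast at hk
    ext i
    fin_cases i <;> simp [Matrix.mulVec, dotProduct, Fin.sum_univ_four] <;> linarith

theorem mulVec_discriminant_generator :
    ((!![0, 1, 1, 1; 1, -2, 0, 2; 1, 0, -2, 3; 1, 2, 3, -2] : Matrix (Fin 4) (Fin 4) ℤ).map
      (Int.cast : ℤ → ℚ)).mulVec ![(13 : ℚ)/31, (5 : ℚ)/31, (12 : ℚ)/31, (14 : ℚ)/31] =
      fun _ => 1 := by
  ext i
  fin_cases i <;> simp [Matrix.mulVec, dotProduct, Fin.sum_univ_four] <;> norm_num

theorem stmt_9 (G : Matrix (Fin 4) (Fin 4) ℤ)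
    (hG : G = !![0, 1, 1, 1; 1, -2, 0, 2; 1, 0, -2, 3; 1, 2, 3, -2]) :
    Nonempty (((Fin 4 → ℤ) ⧸ LinearMap.range (Matrix.mulVecLin G)) ≃+ (ZMod 31)) ∧
    (∀ i, ∃ m : ℤ, (G.map (Int.cast : ℤ → ℚ)).mulVec ![(13 : ℚ)/31, (5 : ℚ)/31, (12 : ℚ)/31, (14 : ℚ)/31] i = m) ∧
    (∃ m : ℤ, ![(13 : ℚ)/31, (5 : ℚ)/31, (12 : ℚ)/31, (14 : ℚ)/31] ⬝ᵥ (G.map (Int.cast : ℤ → ℚ)).mulVec ![(13 : ℚ)/31, (5 : ℚ)/31, (12 : ℚ)/31, (14 : ℚ)/31] - (44 : ℚ)/31 = 2 * m) := by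
  subst hG
  rw [mulVec_discriminant_generator]
  refine ⟨⟨?_⟩, fun _ => ⟨1, by simp⟩, 0, ?_⟩
  · exact (QuotientAddGroup.quotientAddEquivOfEq range_mulVecLin_eq_ker_discriminantHom).trans
      (QuotientAddGroup.quotientKerEquivOfSurjective _ discriminantHom_surjective)
  · simp [dotProduct, Fin.sum_univ_four]
    norm_num
end

section
/- Let G be the symmetric integer matrix [[0,1,1,1,1],[1,-2,2,2,0],[1,2,-2,0,2],[1,2,0,-2,0],[1,0,2,0,-2]] (the Gram matrix of the lattice L_17). Then the cokernel Z^5/(G·Z^5) of the linear map Z^5 → Z^5 given by G is isomorphic as an abelian group to (Z/12Z) ⊕ (Z/2Z) ⊕ (Z/2Z). Moreover the rational vectors α1 = (1/6, 5/6, 1/3, 5/12, 5/12), α2 = (0, 0, 1/2, 0, 1/2), α3 = (0, 1/2, 1/2, 1/2, 1/2) satisfy G·αi ∈ Z^5, and α1ᵀGα1 − 17/12 ∈ 2Z, α2ᵀGα2 ∈ 2Z, α3ᵀGα3 − 1 ∈ 2Z. -/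
open Matrix

/-- A group hom out of an abelian group that is onto and has kernel `S` identifies the quotient
by `S` with its codomain. -/
theorem nonempty_quotient_addEquiv_of_surjective {M A : Type*} [AddCommGroup M] [AddCommGroup A]
    (S : Submodule ℤ M) (f : M →ₗ[ℤ] A) (hf : Function.Surjective f) (hker : LinearMap.ker f = S) :
    Nonempty ((M ⧸ S) ≃+ A) := by
  subst hker
  exact ⟨(f.quotKerEquivOfSurjective hf).toAddEquiv⟩

/-- The linear form `v ↦ c ⬝ᵥ v` reduced modulo `n`. -/
def dotProductMod (n : ℕ) (c : Fin 5 → ℤ) : (Fin 5 → ℤ) →ₗ[ℤ] ZMod n :=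
  (Int.castAddHom (ZMod n)).toIntLinearMap ∘ₗ dotProductBilin ℤ ℤ c

theorem dotProductMod_apply (n : ℕ) (c v : Fin 5 → ℤ) :
    dotProductMod n c v = ((c ⬝ᵥ v : ℤ) : ZMod n) := rfl

/-- The pairings with the three generators of the discriminant group. -/
def discriminantMap : (Fin 5 → ℤ) →ₗ[ℤ] ZMod 12 × ZMod 2 × ZMod 2 :=
  (dotProductMod 12 ![2, 10, 4, 5, 5]).prod
    ((dotProductMod 2 ![0, 0, 1, 0, 1]).prod (dotProductMod 2 ![0, 1, 1, 1, 1]))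

theorem discriminantMap_surjective : Function.Surjective discriminantMap := by
  rintro ⟨x, y, z⟩
  obtain ⟨X, rfl⟩ := ZMod.intCast_surjective x
  obtain ⟨Y, rfl⟩ := ZMod.intCast_surjective y
  obtain ⟨Z, rfl⟩ := ZMod.intCast_surjective z
  refine ⟨![-7 * X - 7 * Y - 5 * Z, X + Y + Z, Y, X, 0], ?_⟩
  simp only [discriminantMap, LinearMap.prod_apply, Function.prod_apply, dotProductMod_apply,
    Prod.mk.injEq, ZMod.intCast_eq_intCast_iff_dvd_sub]
  simp [dotProduct, Fin.sum_univ_five]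
  omega

theorem ker_discriminantMap : LinearMap.ker discriminantMap = LinearMap.range (mulVecLin
    !![0, 1, 1, 1, 1; 1, -2, 2, 2, 0; 1, 2, -2, 0, 2; 1, 2, 0, -2, 0; 1, 0, 2, 0, -2]) := by
  ext v
  simp only [LinearMap.mem_ker, LinearMap.mem_range, discriminantMap, LinearMap.prod_apply,
    Function.prod_apply, dotProductMod_apply, Prod.mk_eq_zero, ZMod.intCast_zmod_eq_zero_iff_dvd,
    mulVecLin_apply, funext_iff, Fin.forall_fin_succ]
  simp only [dotProduct, mulVec, Fin.sum_univ_five]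
  constructor
  · rintro ⟨h₁, h₂, h₃⟩
    refine ⟨![(-4 * v 0 + 4 * v 1 + 4 * v 2 + 2 * v 3 + 2 * v 4) / 12,
      (4 * v 0 - 4 * v 1 + 2 * v 2 - 2 * v 3 + 4 * v 4) / 12,
      (4 * v 0 + 2 * v 1 - 4 * v 2 + 4 * v 3 - 2 * v 4) / 12,
      (2 * v 0 - 2 * v 1 + 4 * v 2 - 7 * v 3 + 5 * v 4) / 12,
      (2 * v 0 + 4 * v 1 - 2 * v 2 + 5 * v 3 - 7 * v 4) / 12], ?_⟩
    simp at h₁ h₂ h₃ ⊢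
    omega
  · rintro ⟨w, hw⟩
    simp at hw ⊢
    omega

theorem stmt_11 (G : Matrix (Fin 5) (Fin 5) ℤ)
    (hG : G = !![0, 1, 1, 1, 1; 1, -2, 2, 2, 0; 1, 2, -2, 0, 2; 1, 2, 0, -2, 0; 1, 0, 2, 0, -2]) :
    Nonempty (((Fin 5 → ℤ) ⧸ LinearMap.range (Matrix.mulVecLin G)) ≃+ (ZMod 12 × ZMod 2 × ZMod 2)) ∧
    (∀ i, ∃ m : ℤ, (G.map (Int.cast : ℤ → ℚ)).mulVec ![(1 : ℚ)/6, (5 : ℚ)/6, (1 : ℚ)/3, (5 : ℚ)/12, (5 : ℚ)/12] i = m) ∧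
    (∃ m : ℤ, ![(1 : ℚ)/6, (5 : ℚ)/6, (1 : ℚ)/3, (5 : ℚ)/12, (5 : ℚ)/12] ⬝ᵥ (G.map (Int.cast : ℤ → ℚ)).mulVec ![(1 : ℚ)/6, (5 : ℚ)/6, (1 : ℚ)/3, (5 : ℚ)/12, (5 : ℚ)/12] - (17 : ℚ)/12 = 2 * m) ∧
    (∀ i, ∃ m : ℤ, (G.map (Int.cast : ℤ → ℚ)).mulVec ![(0 : ℚ), (0 : ℚ), (1 : ℚ)/2, (0 : ℚ), (1 : ℚ)/2] i = m) ∧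
    (∃ m : ℤ, ![(0 : ℚ), (0 : ℚ), (1 : ℚ)/2, (0 : ℚ), (1 : ℚ)/2] ⬝ᵥ (G.map (Int.cast : ℤ → ℚ)).mulVec ![(0 : ℚ), (0 : ℚ), (1 : ℚ)/2, (0 : ℚ), (1 : ℚ)/2] = 2 * m) ∧
    (∀ i, ∃ m : ℤ, (G.map (Int.cast : ℤ → ℚ)).mulVec ![(0 : ℚ), (1 : ℚ)/2, (1 : ℚ)/2, (1 : ℚ)/2, (1 : ℚ)/2] i = m) ∧
    (∃ m : ℤ, ![(0 : ℚ), (1 : ℚ)/2, (1 : ℚ)/2, (1 : ℚ)/2, (1 : ℚ)/2] ⬝ᵥ (G.map (Int.cast : ℤ → ℚ)).mulVec ![(0 : ℚ), (1 : ℚ)/2, (1 : ℚ)/2, (1 : ℚ)/2, (1 : ℚ)/2] - (1 : ℚ) = 2 * m) := by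
  have h₁ : (G.map (Int.cast : ℤ → ℚ)).mulVec
      ![(1 : ℚ)/6, (5 : ℚ)/6, (1 : ℚ)/3, (5 : ℚ)/12, (5 : ℚ)/12] = fun i => ((![2, 0, 2, 1, 0] : Fin 5 → ℤ) i : ℚ) := by
    ext i
    fin_cases i <;> simp [hG, mulVec, dotProduct, Fin.sum_univ_five] <;> norm_num
  have h₂ : (G.map (Int.cast : ℤ → ℚ)).mulVec
      ![(0 : ℚ), (0 : ℚ), (1 : ℚ)/2, (0 : ℚ), (1 : ℚ)/2] = fun i => ((![1, 1, 0, 0, 0] : Fin 5 → ℤ) i : ℚ) := by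
    ext i
    fin_cases i <;> simp [hG, mulVec, dotProduct, Fin.sum_univ_five]
    norm_num
  have h₃ : (G.map (Int.cast : ℤ → ℚ)).mulVec
      ![(0 : ℚ), (1 : ℚ)/2, (1 : ℚ)/2, (1 : ℚ)/2, (1 : ℚ)/2] = fun i => ((![2, 1, 1, 0, 0] : Fin 5 → ℤ) i : ℚ) := by
    ext i
    fin_cases i <;> simp [hG, mulVec, dotProduct, Fin.sum_univ_five]
    norm_num
  subst hG
  refine ⟨nonempty_quotient_addEquiv_of_surjective _ _ discriminantMap_surjective
    ker_discriminantMap, fun i => ⟨_, congrFun h₁ i⟩, ⟨0, ?_⟩, fun i => ⟨_, congrFun h₂ i⟩, ⟨0, ?_⟩,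
    fun i => ⟨_, congrFun h₃ i⟩, ⟨0, ?_⟩⟩
  · rw [h₁]
    simp [dotProduct, Fin.sum_univ_five]
    norm_num
  · rw [h₂]
    simp [dotProduct, Fin.sum_univ_five]
  · rw [h₃]
    simp [dotProduct, Fin.sum_univ_five]
    norm_num
end
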